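/- Exponential concentration for general homomorphism densities in the uniqueness regime (Theorem 3.3): Let H be a fixed finite simple graph with E(H) edges. Assume α > −2 and that g_{α,h} attains its maximum over [0,1] at a unique point u₀* ∈ (0,1). Then for every ε > 0 there exist τ > 0 and N ∈ ℕ such that for all n ≥ N, ℙ_{n;α,h}( { x ∈ 𝒜_n : |t(H, x) − (u₀*)^{E(H)}| ≥ ε } ) ≤ exp(−τ·n²). -/

import Mathlib

open scoped Classical

/-- Number of triangles in the graph `G` on `n` vertices. -/
noncomputable def triCount {n : ℕ} (G : SimpleGraph (Fin n)) : ℕ :=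
  Nat.card {s : Finset (Fin n) // G.IsNClique 3 s}

/-- Number of edges of `G`. -/
noncomputable def edgeCount {n : ℕ} (G : SimpleGraph (Fin n)) : ℕ :=
  Nat.card G.edgeSet

/-- Gibbs weight `exp((α/n)·T_n(G) + h·E_n(G))` of the edge-triangle model. -/
noncomputable def gibbsWeight (α h : ℝ) {n : ℕ} (G : SimpleGraph (Fin n)) : ℝ :=
  Real.exp (α / n * triCount G + h * edgeCount G)

/-- The edge-triangle Gibbs probability of a set `A` of graphs on `n` vertices. -/
noncomputable def gibbsProb (α h : ℝ) (n : ℕ) (A : Set (SimpleGraph (Fin n))) : ℝ :=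
  (∑ G : SimpleGraph (Fin n), if G ∈ A then gibbsWeight α h G else 0) /
  (∑ G : SimpleGraph (Fin n), gibbsWeight α h G)

/-- The energy function `g_{α,h}(u) = (α/6)u³ + (h/2)u − I(u)/2`. -/
noncomputable def gFun (α h u : ℝ) : ℝ :=
  α / 6 * u ^ 3 + h / 2 * u - (u * Real.log u + (1 - u) * Real.log (1 - u)) / 2

/-- The homomorphism density `t(H,G) = hom(H,G) / n^{v(H)}`. -/
noncomputable def homDensity {V : Type} [Fintype V] (H : SimpleGraph V) {n : ℕ}
    (G : SimpleGraph (Fin n)) : ℝ :=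
  (Nat.card (H →g G) : ℝ) / (n : ℝ) ^ (Fintype.card V)

/-- The number of edges of a finite simple graph `H`. -/
noncomputable def edgeNum {V : Type} (H : SimpleGraph V) : ℕ := Nat.card H.edgeSet

/-- A matrix `D` has cut norm at most `t`. -/
def CutLE {α : Type*} (D : α → α → ℝ) (t : ℝ) : Prop :=
  ∀ S T : Finset α, |∑ i ∈ S, ∑ j ∈ T, D i j| ≤ t

theorem abs_sum_mul_le_of_abs_sum_le {α : Type*} [Fintype α] {v g : α → ℝ} {t : ℝ}
    (hv : ∀ T : Finset α, |∑ j ∈ T, v j| ≤ t) (h0 : ∀ j, 0 ≤ g j) (h1 : ∀ j, g j ≤ 1) :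
    |∑ j, g j * v j| ≤ t := by
  rw [abs_le]
  constructor
  · have h := (abs_le.1 (hv (Finset.univ.filter fun j => v j < 0))).1
    refine h.trans ?_
    rw [Finset.sum_filter]
    refine Finset.sum_le_sum fun j _ => ?_
    split_ifs with hj
    · nlinarith [h1 j]
    · exact mul_nonneg (h0 j) (not_lt.1 hj)
  · have h := (abs_le.1 (hv (Finset.univ.filter fun j => 0 < v j))).2
    refine le_trans ?_ h
    rw [Finset.sum_filter]
    refine Finset.sum_le_sum fun j _ => ?_
    split_ifs with hj
    · nlinarith [h1 j]
    · exact mul_nonpos_of_nonneg_of_nonpos (h0 j) (not_lt.1 hj)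

namespace CutLE

variable {α : Type*} {D D' : α → α → ℝ} {t t' : ℝ}

theorem abs_sum_sum_mul_le [Fintype α] (hD : CutLE D t) {f g : α → ℝ}
    (hf0 : ∀ i, 0 ≤ f i) (hf1 : ∀ i, f i ≤ 1) (hg0 : ∀ j, 0 ≤ g j) (hg1 : ∀ j, g j ≤ 1) :
    |∑ i, ∑ j, f i * g j * D i j| ≤ t := by
  have key : ∀ S : Finset α, |∑ i ∈ S, ∑ j, g j * D i j| ≤ t := fun S => by
    have := abs_sum_mul_le_of_abs_sum_le (v := fun j => ∑ i ∈ S, D i j) (g := g)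
      (fun T => by rw [Finset.sum_comm]; exact hD S T) hg0 hg1
    rw [Finset.sum_comm]
    simpa only [Finset.mul_sum] using this
  have := abs_sum_mul_le_of_abs_sum_le key hf0 hf1
  simpa only [Finset.mul_sum, mul_assoc] using this

theorem sub (hD : CutLE D t) (hD' : CutLE D' t') :
    CutLE (fun i j => D i j - D' i j) (t + t') := fun S T => by
  simp only [Finset.sum_sub_distrib]
  exact (abs_sub _ _).trans (add_le_add (hD S T) (hD' S T))

theorem add (hD : CutLE D t) (hD' : CutLE D' t') :
    CutLE (fun i j => D i j + D' i j) (t + t') := fun S T => by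
  simp only [Finset.sum_add_distrib]
  exact (abs_add_le _ _).trans (add_le_add (hD S T) (hD' S T))

theorem sum_mul {ι : Type*} {s : Finset ι} {p : ι → ℝ} {E : ι → α → α → ℝ}
    (hp : ∀ k ∈ s, 0 ≤ p k) (hp1 : ∑ k ∈ s, p k = 1) (hE : ∀ k ∈ s, CutLE (E k) t) :
    CutLE (fun i j => ∑ k ∈ s, p k * E k i j) t := fun S T => by
  have h : ∑ i ∈ S, ∑ j ∈ T, ∑ k ∈ s, p k * E k i j
      = ∑ k ∈ s, p k * ∑ i ∈ S, ∑ j ∈ T, E k i j := by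
    simp only [Finset.mul_sum]
    rw [Finset.sum_congr rfl fun i _ => Finset.sum_comm, Finset.sum_comm]
  rw [h]
  calc |∑ k ∈ s, p k * ∑ i ∈ S, ∑ j ∈ T, E k i j|
      ≤ ∑ k ∈ s, |p k * ∑ i ∈ S, ∑ j ∈ T, E k i j| := Finset.abs_sum_le_sum_abs _ _
    _ ≤ ∑ k ∈ s, p k * t := Finset.sum_le_sum fun k hk => by
        rw [abs_mul, abs_of_nonneg (hp k hk)]
        exact mul_le_mul_of_nonneg_left (hE k hk S T) (hp k hk)
    _ = t := by rw [← Finset.sum_mul, hp1, one_mul]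

theorem of_sum_abs_le [Fintype α] (h : ∑ i, ∑ j, |D i j| ≤ t) : CutLE D t := fun S T => by
  refine le_trans ?_ h
  refine (Finset.abs_sum_le_sum_abs _ _).trans ?_
  refine le_trans (Finset.sum_le_sum fun i _ => (Finset.abs_sum_le_sum_abs _ _).trans
    (Finset.sum_le_univ_sum_of_nonneg fun j => abs_nonneg (D i j))) ?_
  exact Finset.sum_le_univ_sum_of_nonneg fun i => Finset.sum_nonneg fun j _ => abs_nonneg _

end CutLE

/-- A combination of rectangles with coefficients `±δ`, encoded by signs and sides. -/
noncomputable def rectSum {α : Type*} (δ : ℝ) {k : ℕ}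
    (c : Fin k → Bool × Finset α × Finset α) (i j : α) : ℝ :=
  ∑ l, if i ∈ (c l).2.1 ∧ j ∈ (c l).2.2 then (if (c l).1 then δ else -δ) else 0

/-- Weak regularity: a matrix of bounded energy is close in cut norm to a short combination of
rectangles with coefficients `±δ`. -/
theorem exists_rectSum_cutLE {α : Type*} [Fintype α] {δ : ℝ} (hδ : 0 ≤ δ) (k : ℕ)
    (B : α → α → ℝ)
    (hB : ∑ i, ∑ j, B i j ^ 2 ≤ k * (δ ^ 2 * (Fintype.card α : ℝ) ^ 2)) :
    ∃ c : Fin k → Bool × Finset α × Finset α,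
      CutLE (fun i j => B i j - rectSum δ c i j) (δ * (Fintype.card α : ℝ) ^ 2) := by
  induction k generalizing B with
  | zero =>
    refine ⟨Fin.elim0, fun S T => ?_⟩
    have hz : ∀ i j, B i j = 0 := fun i j => by
      have h1 : ∑ i, ∑ j, B i j ^ 2 = 0 :=
        le_antisymm (by simpa using hB)
          (Finset.sum_nonneg fun i _ => Finset.sum_nonneg fun j _ => sq_nonneg _)
      have h2 := (Finset.sum_eq_zero_iff_of_nonneg
        (fun i _ => Finset.sum_nonneg fun j _ => sq_nonneg (B i j))).1 h1 i (Finset.mem_univ _)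
      have h3 := (Finset.sum_eq_zero_iff_of_nonneg
        (fun j _ => sq_nonneg (B i j))).1 h2 j (Finset.mem_univ _)
      exact pow_eq_zero_iff (two_ne_zero) |>.1 h3
    simp only [rectSum, hz, Finset.univ_eq_empty, Finset.sum_empty, sub_zero,
      Finset.sum_const_zero, abs_zero]
    positivity
  | succ k ih =>
    by_cases hgood : CutLE B (δ * (Fintype.card α : ℝ) ^ 2)
    · exact ⟨fun _ => (true, ∅, ∅), by simpa [rectSum] using hgood⟩
    · simp only [CutLE, not_forall, not_le] at hgood
      obtain ⟨S, T, hST⟩ := hgood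
      obtain ⟨b, hb⟩ : ∃ b : Bool, δ * (Fintype.card α : ℝ) ^ 2
          < (if b then (1 : ℝ) else -1) * ∑ i ∈ S, ∑ j ∈ T, B i j := by
        rcases lt_abs.1 hST with h | h
        · exact ⟨true, by simpa using h⟩
        · exact ⟨false, by simpa using h⟩
      set σ : ℝ := if b then (1 : ℝ) else -1 with hσ
      have hσ2 : σ ^ 2 = 1 := by rw [hσ]; split_ifs <;> norm_num
      set R : α → α → ℝ := fun i j => if i ∈ S ∧ j ∈ T then 1 else 0 with hR
      have hR2 : ∀ i j, R i j ^ 2 ≤ 1 := fun i j => by simp only [hR]; split_ifs <;> norm_num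
      have hBR : ∑ i, ∑ j, B i j * R i j = ∑ i ∈ S, ∑ j ∈ T, B i j := by
        have hrow : ∀ i, ∑ j, B i j * R i j = if i ∈ S then ∑ j ∈ T, B i j else 0 := fun i => by
          by_cases hi : i ∈ S <;> simp [hR, hi]
        simp [hrow]
      have hRR : ∑ i, ∑ j, R i j ^ 2 ≤ (Fintype.card α : ℝ) ^ 2 :=
        (Finset.sum_le_sum fun i _ => Finset.sum_le_sum fun j _ => hR2 i j).trans
          (by simp [sq])
      have hexp : ∑ i, ∑ j, (B i j - δ * σ * R i j) ^ 2
          = ∑ i, ∑ j, B i j ^ 2 - 2 * δ * (σ * ∑ i, ∑ j, B i j * R i j)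
            + δ ^ 2 * ∑ i, ∑ j, R i j ^ 2 := by
        simp only [Finset.mul_sum, ← Finset.sum_add_distrib, ← Finset.sum_sub_distrib]
        refine Finset.sum_congr rfl fun i _ => Finset.sum_congr rfl fun j _ => ?_
        linear_combination δ ^ 2 * R i j ^ 2 * hσ2
      obtain ⟨c, hc⟩ := ih (fun i j => B i j - δ * σ * R i j) (by
        rw [hexp, hBR]
        push_cast at hB
        nlinarith [mul_le_mul_of_nonneg_left hb.le hδ, sq_nonneg δ,
          mul_le_mul_of_nonneg_left hRR (sq_nonneg δ)])
      refine ⟨Fin.cons (b, S, T) c, fun S' T' => ?_⟩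
      convert hc S' T' using 5 with i _ j _
      simp only [rectSum, Fin.sum_univ_succ, Fin.cons_zero, Fin.cons_succ, hR, hσ]
      split_ifs <;> ring

theorem sum_sum_update {V α : Type*} [Fintype V] [Fintype α] (F : (V → α) → ℝ) (p : V) :
    ∑ φ : V → α, ∑ x, F (Function.update φ p x) = Fintype.card α * ∑ φ, F φ := by
  have h : ∑ z : (V → α) × α, F (Function.update z.1 p z.2) = ∑ z : (V → α) × α, F z.1 :=
    Finset.sum_bij' (fun z _ => (Function.update z.1 p z.2, z.1 p))
      (fun z _ => (Function.update z.1 p z.2, z.1 p)) (by simp) (by simp) (by simp) (by simp)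
      (by simp)
  rw [Fintype.sum_prod_type, Fintype.sum_prod_type] at h
  simp only [h, Finset.sum_const, Finset.card_univ, nsmul_eq_mul, Finset.mul_sum]

theorem abs_sum_prod_mul_le_of_cutLE {V α ι : Type*} [Fintype V] [Fintype α] [Nonempty α]
    {s : Finset ι} {a b : ι → V} {p q : V} (hpq : p ≠ q)
    (hs : ∀ f ∈ s, s(a f, b f) ≠ s(p, q)) (hab : ∀ f ∈ s, a f ≠ b f)
    {U : ι → α → α → ℝ} (hU0 : ∀ f i j, 0 ≤ U f i j) (hU1 : ∀ f i j, U f i j ≤ 1)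
    {D : α → α → ℝ} {δ : ℝ} (hD : CutLE D (δ * (Fintype.card α : ℝ) ^ 2)) :
    |∑ φ : V → α, (∏ f ∈ s, U f (φ (a f)) (φ (b f))) * D (φ p) (φ q)|
      ≤ δ * (Fintype.card α : ℝ) ^ Fintype.card V := by
  have hn : (0 : ℝ) < Fintype.card α := by exact_mod_cast Fintype.card_pos
  set F : (V → α) → ℝ := fun φ => (∏ f ∈ s, U f (φ (a f)) (φ (b f))) * D (φ p) (φ q) with hF
  have havg : (Fintype.card α : ℝ) ^ 2 * ∑ φ, F φ
      = ∑ φ : V → α, ∑ x, ∑ y, F (Function.update (Function.update φ p x) q y) := by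
    rw [sum_sum_update (fun φ => ∑ y, F (Function.update φ q y)) p, sum_sum_update F q]
    ring
  have hbound : ∀ φ : V → α,
      |∑ x, ∑ y, F (Function.update (Function.update φ p x) q y)|
        ≤ δ * (Fintype.card α : ℝ) ^ 2 := fun φ => by
    set P : (V → α) → Finset ι → ℝ := fun ψ r => ∏ f ∈ r, U f (ψ (a f)) (ψ (b f)) with hP
    have hP0 : ∀ ψ r, 0 ≤ P ψ r := fun ψ r => Finset.prod_nonneg fun f _ => hU0 _ _ _
    have hP1 : ∀ ψ r, P ψ r ≤ 1 := fun ψ r =>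
      Finset.prod_le_one (fun f _ => hU0 _ _ _) fun f _ => hU1 _ _ _
    set s₁ := s.filter fun f => a f ≠ q ∧ b f ≠ q with hs₁
    set s₂ := s.filter fun f => ¬ (a f ≠ q ∧ b f ≠ q) with hs₂
    have hsplit : ∀ x y, F (Function.update (Function.update φ p x) q y)
        = P (Function.update φ p x) s₁ * P (Function.update φ q y) s₂ * D x y := fun x y => by
      simp only [hF]
      congr 1
      · rw [← Finset.prod_filter_mul_prod_filter_not s (fun f => a f ≠ q ∧ b f ≠ q)]
        congr 1
        · refine Finset.prod_congr rfl fun f hf => ?_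
          obtain ⟨-, h1, h2⟩ := Finset.mem_filter.1 hf
          rw [Function.update_of_ne h1, Function.update_of_ne h2]
        · refine Finset.prod_congr rfl fun f hf => ?_
          obtain ⟨hfs, hf⟩ := Finset.mem_filter.1 hf
          have h1 := hs f hfs
          have h2 := hab f hfs
          have h3 : a f ≠ p ∧ b f ≠ p := by
            rw [Ne, Sym2.eq_iff] at h1
            grind
          rw [Function.update_comm hpq, Function.update_of_ne h3.1, Function.update_of_ne h3.2]
      · simp [Function.update_of_ne hpq]
    simp only [hsplit]
    exact hD.abs_sum_sum_mul_le (fun _ => hP0 _ _) (fun _ => hP1 _ _) (fun _ => hP0 _ _)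
      (fun _ => hP1 _ _)
  have h : (Fintype.card α : ℝ) ^ 2 * |∑ φ, F φ|
      ≤ (Fintype.card α : ℝ) ^ 2 * (δ * (Fintype.card α : ℝ) ^ Fintype.card V) := by
    rw [← abs_of_pos (pow_pos hn 2), ← abs_mul, abs_of_pos (pow_pos hn 2), havg]
    refine (Finset.abs_sum_le_sum_abs _ _).trans ((Finset.sum_le_sum fun φ _ => hbound φ).trans ?_)
    simp only [Finset.sum_const, Finset.card_univ, nsmul_eq_mul, Fintype.card_fun, Nat.cast_pow]
    exact le_of_eq (by ring)
  exact le_of_mul_le_mul_left h (pow_pos hn 2)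

/-- Counting lemma: homomorphism sums are Lipschitz in the cut norm. -/
theorem abs_sum_prod_sub_sum_prod_le {V α ι : Type*} [Fintype V] [Fintype α] [Nonempty α]
    {s : Finset ι} {a b : ι → V} (hab : ∀ f ∈ s, a f ≠ b f)
    (hs : ∀ e ∈ s, ∀ f ∈ s, e ≠ f → s(a e, b e) ≠ s(a f, b f))
    {W W' : α → α → ℝ} (hW0 : ∀ i j, 0 ≤ W i j) (hW1 : ∀ i j, W i j ≤ 1)
    (hW0' : ∀ i j, 0 ≤ W' i j) (hW1' : ∀ i j, W' i j ≤ 1) {δ : ℝ}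
    (hD : CutLE (fun i j => W i j - W' i j) (δ * (Fintype.card α : ℝ) ^ 2)) :
    |∑ φ : V → α, ∏ f ∈ s, W (φ (a f)) (φ (b f)) - ∑ φ : V → α, ∏ f ∈ s, W' (φ (a f)) (φ (b f))|
      ≤ s.card * (δ * (Fintype.card α : ℝ) ^ Fintype.card V) := by
  set U : Finset ι → ι → α → α → ℝ := fun r f => if f ∈ r then W else W' with hU
  have key : ∀ r ⊆ s, |∑ φ : V → α, ∏ f ∈ s, U r f (φ (a f)) (φ (b f))
      - ∑ φ : V → α, ∏ f ∈ s, W' (φ (a f)) (φ (b f))|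
      ≤ r.card * (δ * (Fintype.card α : ℝ) ^ Fintype.card V) := by
    intro r
    induction r using Finset.induction_on with
    | empty => intro _; simp [hU]
    | insert e r her ih =>
      intro hr
      have hes : e ∈ s := hr (Finset.mem_insert_self e r)
      have h1 := ih fun x hx => hr (Finset.mem_insert_of_mem hx)
      have h2 := abs_sum_prod_mul_le_of_cutLE (s := s.erase e) (a := a) (b := b) (hab e hes)
        (fun f hf => hs f (Finset.mem_of_mem_erase hf) e hes (Finset.ne_of_mem_erase hf))
        (fun f hf => hab f (Finset.mem_of_mem_erase hf)) (U := U r)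
        (fun f i j => by simp only [hU]; split_ifs; exacts [hW0 i j, hW0' i j])
        (fun f i j => by simp only [hU]; split_ifs; exacts [hW1 i j, hW1' i j]) hD
      have h3 : ∀ φ : V → α, (∏ f ∈ s.erase e, U r f (φ (a f)) (φ (b f)))
          * (W (φ (a e)) (φ (b e)) - W' (φ (a e)) (φ (b e)))
          = ∏ f ∈ s, U (insert e r) f (φ (a f)) (φ (b f))
            - ∏ f ∈ s, U r f (φ (a f)) (φ (b f)) := fun φ => by
        rw [← Finset.mul_prod_erase s _ hes, ← Finset.mul_prod_erase s _ hes]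
        have h4 : ∏ f ∈ s.erase e, U (insert e r) f (φ (a f)) (φ (b f))
            = ∏ f ∈ s.erase e, U r f (φ (a f)) (φ (b f)) :=
          Finset.prod_congr rfl fun f hf => by
            simp [hU, Finset.mem_insert, Finset.ne_of_mem_erase hf]
        rw [h4]
        simp only [hU, Finset.mem_insert_self, if_true, her, if_false]
        ring
      simp only [h3, Finset.sum_sub_distrib] at h2
      rw [Finset.card_insert_of_notMem her]
      push_cast
      calc _ ≤ _ := abs_sub_le _ (∑ φ : V → α, ∏ f ∈ s, U r f (φ (a f)) (φ (b f))) _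
        _ ≤ _ := add_le_add h2 h1
        _ = _ := by ring
  have := key s subset_rfl
  rwa [Finset.sum_congr rfl fun φ _ => Finset.prod_congr rfl fun f hf => by
    rw [show U s f = W by simp [hU, hf]]] at this

/-- The adjacency matrix of `G` with real entries. -/
noncomputable def adjW {n : ℕ} (G : SimpleGraph (Fin n)) (i j : Fin n) : ℝ :=
  if G.Adj i j then 1 else 0

theorem adjW_nonneg {n : ℕ} (G : SimpleGraph (Fin n)) (i j : Fin n) : 0 ≤ adjW G i j := by
  unfold adjW; split_ifs <;> norm_num

theorem adjW_le_one {n : ℕ} (G : SimpleGraph (Fin n)) (i j : Fin n) : adjW G i j ≤ 1 := by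
  unfold adjW; split_ifs <;> norm_num

theorem adjW_comm {n : ℕ} (G : SimpleGraph (Fin n)) (i j : Fin n) : adjW G i j = adjW G j i := by
  simp only [adjW, G.adj_comm]

theorem card_hom_eq_sum_prod {V : Type} [Fintype V] (H : SimpleGraph V) {n : ℕ}
    (G : SimpleGraph (Fin n)) :
    (Nat.card (H →g G) : ℝ)
      = ∑ φ : V → Fin n, ∏ e ∈ H.edgeFinset, adjW G (φ e.out.1) (φ e.out.2) := by
  have hP : ∀ φ : V → Fin n, (∏ e ∈ H.edgeFinset, adjW G (φ e.out.1) (φ e.out.2))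
      = if ∀ a b, H.Adj a b → G.Adj (φ a) (φ b) then 1 else 0 := fun φ => by
    simp only [adjW, Finset.prod_ite_zero, Finset.prod_const_one]
    refine if_congr ⟨fun h a b hab => ?_, fun h e he => ?_⟩ rfl rfl
    · have h1 := h s(a, b) (by simpa using hab)
      have h2 : s((s(a, b) : Sym2 V).out.1, (s(a, b) : Sym2 V).out.2) = s(a, b) :=
        Quot.out_eq (s(a, b) : Sym2 V)
      rcases Sym2.eq_iff.1 h2 with ⟨h3, h4⟩ | ⟨h3, h4⟩
      · rwa [h3, h4] at h1
      · rw [h3, h4] at h1; exact h1.symm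
    · refine h _ _ ?_
      have h2 : s(e.out.1, e.out.2) = e := Quot.out_eq e
      rw [← SimpleGraph.mem_edgeSet, h2]
      simpa using he
  simp only [hP]
  rw [Finset.sum_boole, ← Fintype.card_subtype, ← Nat.card_eq_fintype_card]
  congr 1
  exact Nat.card_congr
    { toFun := fun f => ⟨f, fun a b h => f.map_rel h⟩
      invFun := fun f => ⟨f.1, fun {a b} h => f.2 a b h⟩
      left_inv := fun f => rfl
      right_inv := fun f => rfl }

theorem abs_homDensity_sub_pow_le {V : Type} [Fintype V] (H : SimpleGraph V) {n : ℕ} (hn : 0 < n)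
    (G : SimpleGraph (Fin n)) {u δ : ℝ} (hu0 : 0 ≤ u) (hu1 : u ≤ 1)
    (hG : CutLE (fun i j => adjW G i j - u) (δ * (n : ℝ) ^ 2)) :
    |homDensity H G - u ^ edgeNum H| ≤ edgeNum H * δ := by
  have : Nonempty (Fin n) := ⟨⟨0, hn⟩⟩
  have hout : ∀ e : Sym2 V, s(e.out.1, e.out.2) = e := fun e => Quot.out_eq e
  have h := abs_sum_prod_sub_sum_prod_le (s := H.edgeFinset) (a := fun e => e.out.1)
    (b := fun e => e.out.2) (W := adjW G) (W' := fun _ _ => u) (δ := δ)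
    (fun e he => by
      have : s(e.out.1, e.out.2) ∈ H.edgeSet := by rw [hout]; simpa using he
      exact (SimpleGraph.mem_edgeSet H).1 this |>.ne)
    (fun e _ f _ hef => by simpa only [hout] using hef)
    (adjW_nonneg G) (adjW_le_one G) (fun _ _ => hu0) (fun _ _ => hu1)
    (by simpa using hG)
  have hE : H.edgeFinset.card = edgeNum H := by
    rw [edgeNum, Nat.card_eq_fintype_card, SimpleGraph.edgeFinset_card]
  rw [← card_hom_eq_sum_prod] at h
  simp only [Finset.prod_const, Finset.sum_const, Finset.card_univ, nsmul_eq_mul,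
    Fintype.card_fun, Fintype.card_fin, hE] at h
  have hpos : (0 : ℝ) < (n : ℝ) ^ Fintype.card V := by positivity
  rw [homDensity, div_sub' hpos.ne', abs_div, abs_of_pos hpos, div_le_iff₀ hpos]
  push_cast at h
  linarith

/-- The sum of `W i j * W j k * W k i` over all triples. -/
def triSum {α : Type*} [Fintype α] (W : α → α → ℝ) : ℝ :=
  ∑ i, ∑ j, ∑ k, W i j * W j k * W k i

theorem abs_triSum_sub_triSum_le {α : Type*} [Fintype α] [Nonempty α]
    {W W' : α → α → ℝ} (hW0 : ∀ i j, 0 ≤ W i j) (hW1 : ∀ i j, W i j ≤ 1)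
    (hW0' : ∀ i j, 0 ≤ W' i j) (hW1' : ∀ i j, W' i j ≤ 1) {δ : ℝ}
    (hD : CutLE (fun i j => W i j - W' i j) (δ * (Fintype.card α : ℝ) ^ 2)) :
    |triSum W - triSum W'| ≤ 3 * (δ * (Fintype.card α : ℝ) ^ 3) := by
  have hconv : ∀ X : α → α → ℝ,
      ∑ φ : Fin 3 → α, ∏ f : Fin 3, X (φ f) (φ (f + 1)) = triSum X := fun X => by
    simp only [triSum, ← Fintype.sum_prod_type']
    refine Finset.sum_bij' (fun φ _ => (φ 0, φ 1, φ 2)) (fun z _ => ![z.1, z.2.1, z.2.2])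
      (by simp) (by simp) (fun φ _ => ?_) (by simp) (fun φ _ => ?_)
    · ext i; fin_cases i <;> rfl
    · rw [Fin.prod_univ_three]; rfl
  have h := abs_sum_prod_sub_sum_prod_le (V := Fin 3) (s := Finset.univ) (a := fun f => f)
    (b := fun f => f + 1) (by decide) (by decide) hW0 hW1 hW0' hW1' hD
  rw [← hconv W, ← hconv W']
  convert h <;> simp

theorem six_mul_triCount {n : ℕ} (G : SimpleGraph (Fin n)) :
    6 * (triCount G : ℝ) = triSum (adjW G) := by
  set T : Finset (Fin n × Fin n × Fin n) :=
    Finset.univ.filter fun z => G.Adj z.1 z.2.1 ∧ G.Adj z.2.1 z.2.2 ∧ G.Adj z.2.2 z.1 with hT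
  have h1 : triSum (adjW G) = (T.card : ℝ) := by
    rw [hT, ← Finset.sum_boole, Fintype.sum_prod_type]
    simp only [triSum, Fintype.sum_prod_type]
    refine Finset.sum_congr rfl fun i _ => Finset.sum_congr rfl fun j _ =>
      Finset.sum_congr rfl fun k _ => ?_
    simp only [adjW]
    split_ifs <;> simp_all
  have h2 : triCount G = (G.cliqueFinset 3).card := by
    rw [triCount, Nat.card_eq_fintype_card, Fintype.card_subtype]
    congr 1
  have h3 : T.card = 6 * (G.cliqueFinset 3).card := by
    rw [Finset.card_eq_sum_card_fiberwise (f := fun z => ({z.1, z.2.1, z.2.2} : Finset (Fin n)))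
      (t := G.cliqueFinset 3), Finset.sum_const_nat (m := 6), mul_comm]
    · intro s hs
      obtain ⟨a, b, c, hab, hac, hbc, rfl⟩ :=
        SimpleGraph.is3Clique_iff.1 ((SimpleGraph.mem_cliqueFinset_iff).1 hs)
      have : (T.filter fun z => ({z.1, z.2.1, z.2.2} : Finset (Fin n)) = {a, b, c})
          = {(a, b, c), (a, c, b), (b, a, c), (b, c, a), (c, a, b), (c, b, a)} := by
        have nab := hab.ne
        have nac := hac.ne
        have nbc := hbc.ne
        ext ⟨x, y, z⟩
        simp only [hT, Finset.mem_filter, Finset.mem_univ, true_and, Finset.mem_insert,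
          Finset.mem_singleton, Prod.mk.injEq]
        constructor
        · rintro ⟨⟨hxy, hyz, hzx⟩, he⟩
          have nxy := hxy.ne
          have nyz := hyz.ne
          have nzx := hzx.ne
          have hx : x ∈ ({a, b, c} : Finset (Fin n)) := he ▸ by simp
          have hy : y ∈ ({a, b, c} : Finset (Fin n)) := he ▸ by simp
          have hz : z ∈ ({a, b, c} : Finset (Fin n)) := he ▸ by simp
          simp only [Finset.mem_insert, Finset.mem_singleton] at hx hy hz
          grind
        · have := hab.symm
          have := hac.symm
          have := hbc.symm
          rintro (⟨rfl, rfl, rfl⟩ | ⟨rfl, rfl, rfl⟩ | ⟨rfl, rfl, rfl⟩ | ⟨rfl, rfl, rfl⟩ |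
            ⟨rfl, rfl, rfl⟩ | ⟨rfl, rfl, rfl⟩) <;>
          refine ⟨⟨by assumption, by assumption, by assumption⟩, ?_⟩ <;>
          · ext w; simp only [Finset.mem_insert, Finset.mem_singleton]; try tauto
      rw [this]
      have nab := hab.ne
      have nac := hac.ne
      have nbc := hbc.ne
      have := nab.symm
      have := nac.symm
      have := nbc.symm
      simp [Finset.card_insert_of_notMem, *]
    · rintro ⟨x, y, z⟩ hz
      simp only [hT, Finset.coe_filter, Finset.mem_univ, true_and, Set.mem_ofPred_eq] at hz
      simp only [Finset.mem_coe, SimpleGraph.mem_cliqueFinset_iff, SimpleGraph.is3Clique_iff]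
      exact ⟨x, y, z, hz.1, hz.2.2.symm, hz.2.1, rfl⟩
  rw [h1, h2, h3]
  push_cast
  ring

/-- The edges of the complete graph on `n` vertices. -/
noncomputable def edgesK (n : ℕ) : Finset (Sym2 (Fin n)) :=
  Finset.univ.filter fun e => ¬ e.IsDiag

theorem sum_sum_ite_eq_two_mul_sum_edgesK {n : ℕ} (f : Sym2 (Fin n) → ℝ) :
    ∑ i, ∑ j, (if i = j then 0 else f s(i, j)) = 2 * ∑ e ∈ edgesK n, f e := by
  have h := Finset.sum_sym2_filter_not_isDiag (Finset.univ : Finset (Fin n)) f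
  have h1 : ∑ e ∈ edgesK n, f e = ∑ i, ∑ j, if i < j then f s(i, j) else 0 := by
    rw [← Fintype.sum_prod_type', ← Finset.sum_filter]
    simp only [edgesK]
    rw [Finset.sym2_univ] at h
    convert h using 2
    ext z
    simp only [Finset.mem_filter, Finset.mem_univ, true_and, Finset.mem_offDiag]
    exact ⟨fun h => ⟨h.ne, h⟩, fun h => h.2⟩
  have h2 : ∑ e ∈ edgesK n, f e = ∑ i, ∑ j, if j < i then f s(i, j) else 0 := by
    rw [h1, Finset.sum_comm]
    simp only [Sym2.eq_swap]
  rw [two_mul]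
  nth_rewrite 1 [h1]
  rw [h2]
  simp only [← Finset.sum_add_distrib]
  refine Finset.sum_congr rfl fun i _ => Finset.sum_congr rfl fun j _ => ?_
  rcases lt_trichotomy i j with hij | hij | hij
  · simp [hij, hij.ne, hij.not_gt]
  · simp [hij]
  · simp [hij, hij.ne', hij.not_gt]

theorem two_mul_edgeCount {n : ℕ} (G : SimpleGraph (Fin n)) :
    2 * (edgeCount G : ℝ) = ∑ i, ∑ j, adjW G i j := by
  have h := sum_sum_ite_eq_two_mul_sum_edgesK fun e => if e ∈ G.edgeSet then 1 else 0
  have h1 : edgeCount G = ((edgesK n).filter (· ∈ G.edgeSet)).card := by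
    rw [edgeCount, Nat.card_eq_fintype_card, ← SimpleGraph.edgeFinset_card]
    congr 1
    ext e
    simp only [SimpleGraph.mem_edgeFinset, edgesK, Finset.mem_filter, Finset.mem_univ, true_and]
    exact ⟨fun h => ⟨G.not_isDiag_of_mem_edgeSet h, h⟩, fun h => h.2⟩
  rw [Finset.sum_boole, ← h1] at h
  rw [← h]
  refine Finset.sum_congr rfl fun i _ => Finset.sum_congr rfl fun j _ => ?_
  by_cases hij : i = j
  · simp [adjW, hij]
  · simp [adjW, hij, SimpleGraph.mem_edgeSet]

theorem mem_edgesK {n : ℕ} {e : Sym2 (Fin n)} : e ∈ edgesK n ↔ ¬ e.IsDiag := by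
  simp [edgesK]

theorem sum_simpleGraph_prod_ite {n : ℕ} (a b : Sym2 (Fin n) → ℝ) :
    ∑ G : SimpleGraph (Fin n), ∏ e ∈ edgesK n, (if e ∈ G.edgeSet then a e else b e)
      = ∏ e ∈ edgesK n, (a e + b e) := by
  have hsub : ∀ G : SimpleGraph (Fin n), ∀ e ∈ G.edgeSet, e ∈ edgesK n := fun G e he =>
    mem_edgesK.2 (G.not_isDiag_of_mem_edgeSet he)
  rw [Finset.prod_add]
  refine Finset.sum_bij' (fun G _ => (edgesK n).filter (· ∈ G.edgeSet))
    (fun s _ => SimpleGraph.fromEdgeSet (s : Set (Sym2 (Fin n)))) ?_ ?_ ?_ ?_ ?_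
  · intro G _
    exact Finset.mem_powerset.2 (Finset.filter_subset _ _)
  · simp
  · intro G _
    have : (((edgesK n).filter (· ∈ G.edgeSet) : Finset (Sym2 (Fin n))) : Set (Sym2 (Fin n)))
        = G.edgeSet := by
      ext e
      simpa using hsub G e
    simp only [this, SimpleGraph.fromEdgeSet_edgeSet]
  · intro s hs
    ext e
    simp only [SimpleGraph.edgeSet_fromEdgeSet, Finset.mem_filter, Set.mem_sdiff, Finset.mem_coe]
    have := Finset.mem_powerset.1 hs
    exact ⟨fun h => h.2.1, fun h => ⟨this h, h, mem_edgesK.1 (this h)⟩⟩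
  · intro G _
    rw [Finset.prod_ite, Finset.filter_not]

/-- The weight of `G` when edges are independent with probabilities `M e`. -/
noncomputable def bern {n : ℕ} (M : Sym2 (Fin n) → ℝ) (G : SimpleGraph (Fin n)) : ℝ :=
  ∏ e ∈ edgesK n, if e ∈ G.edgeSet then M e else 1 - M e

theorem sum_bern {n : ℕ} (M : Sym2 (Fin n) → ℝ) : ∑ G, bern M G = 1 := by
  simp [bern, sum_simpleGraph_prod_ite]

theorem bern_nonneg {n : ℕ} {M : Sym2 (Fin n) → ℝ} (h0 : ∀ e, 0 ≤ M e) (h1 : ∀ e, M e ≤ 1)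
    (G : SimpleGraph (Fin n)) : 0 ≤ bern M G :=
  Finset.prod_nonneg fun e _ => by split_ifs; exacts [h0 e, sub_nonneg.2 (h1 e)]

theorem sum_bern_mul_ite_subset {n : ℕ} (u : ℝ) {s : Finset (Sym2 (Fin n))}
    (hs : s ⊆ edgesK n) :
    ∑ G, bern (fun _ => u) G * (if ∀ e ∈ s, e ∈ G.edgeSet then 1 else 0) = u ^ s.card := by
  have h := sum_simpleGraph_prod_ite (n := n) (fun _ => u) fun e => if e ∈ s then 0 else 1 - u
  have h1 : ∏ e ∈ edgesK n, (u + if e ∈ s then 0 else 1 - u) = u ^ s.card := by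
    rw [Finset.prod_congr rfl fun e _ =>
      show (u + if e ∈ s then 0 else 1 - u) = if e ∈ s then u else 1 by split_ifs <;> ring]
    rw [Finset.prod_ite_mem, Finset.inter_eq_right.2 hs, Finset.prod_const]
  rw [← h1, ← h]
  refine Finset.sum_congr rfl fun G _ => ?_
  by_cases hG : ∀ e ∈ s, e ∈ G.edgeSet
  · rw [if_pos hG, mul_one]
    refine Finset.prod_congr rfl fun e _ => ?_
    by_cases he : e ∈ s
    · simp [hG e he]
    · simp [he]
  · rw [if_neg hG, mul_zero]
    push Not at hG
    obtain ⟨e, he, heG⟩ := hG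
    exact (Finset.prod_eq_zero (hs he) (by simp [he, heG])).symm

theorem sum_mul_log_le_sum_mul_log {ι : Type*} {s : Finset ι} {p r : ι → ℝ}
    (hp : ∀ x ∈ s, 0 < p x) (hr : ∀ x ∈ s, 0 < r x) (hp1 : ∑ x ∈ s, p x = 1)
    (hr1 : ∑ x ∈ s, r x ≤ 1) :
    ∑ x ∈ s, p x * Real.log (r x) ≤ ∑ x ∈ s, p x * Real.log (p x) := by
  have h : ∀ x ∈ s, p x * Real.log (r x) - p x * Real.log (p x) ≤ r x - p x := fun x hx => by
    have h1 := Real.log_le_sub_one_of_pos (div_pos (hr x hx) (hp x hx))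
    rw [Real.log_div (hr x hx).ne' (hp x hx).ne'] at h1
    have h2 := mul_le_mul_of_nonneg_left h1 (hp x hx).le
    have h3 : p x * (r x / p x - 1) = r x - p x := by
      have := (hp x hx).ne'
      field_simp
    linarith
  have h4 := Finset.sum_le_sum h
  rw [Finset.sum_sub_distrib, Finset.sum_sub_distrib] at h4
  linarith

/-- The negative entropy of a Bernoulli variable with mean `u`. -/
noncomputable def negEnt (u : ℝ) : ℝ := u * Real.log u + (1 - u) * Real.log (1 - u)

theorem sum_mul_log_bern {n : ℕ} {S : Finset (SimpleGraph (Fin n))}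
    {μ : SimpleGraph (Fin n) → ℝ} (hμ : ∑ G ∈ S, μ G = 1) {M : Sym2 (Fin n) → ℝ}
    (hM : ∀ e ∈ edgesK n, ∑ G ∈ S, μ G * (if e ∈ G.edgeSet then 1 else 0) = M e)
    (hne : ∀ G ∈ S, ∀ e ∈ edgesK n, (if e ∈ G.edgeSet then M e else 1 - M e) ≠ 0) :
    ∑ G ∈ S, μ G * Real.log (bern M G) = ∑ e ∈ edgesK n, negEnt (M e) := by
  have h1 : ∀ G ∈ S, μ G * Real.log (bern M G) = ∑ e ∈ edgesK n,
      ((μ G * (if e ∈ G.edgeSet then 1 else 0)) * (Real.log (M e) - Real.log (1 - M e))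
        + μ G * Real.log (1 - M e)) := fun G hG => by
    rw [bern, Real.log_prod (hne G hG), Finset.mul_sum]
    refine Finset.sum_congr rfl fun e _ => ?_
    split_ifs <;> ring
  rw [Finset.sum_congr rfl h1, Finset.sum_comm]
  refine Finset.sum_congr rfl fun e he => ?_
  rw [Finset.sum_add_distrib, ← Finset.sum_mul, ← Finset.sum_mul, hM e he, hμ, negEnt]
  ring

/-- The Gibbs variational upper bound over a set `S` of graphs, with the entropy of the
conditional measure replaced by that of the product measure with the same edge marginals. -/
theorem log_sum_exp_le {n : ℕ} {S : Finset (SimpleGraph (Fin n))}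
    (f : SimpleGraph (Fin n) → ℝ) {μ : SimpleGraph (Fin n) → ℝ} (hS : S.Nonempty)
    (hμ : ∀ G, μ G = Real.exp (f G) / ∑ G' ∈ S, Real.exp (f G')) {M : Sym2 (Fin n) → ℝ}
    (hM : ∀ e, M e = ∑ G ∈ S, μ G * (if e ∈ G.edgeSet then 1 else 0)) :
    Real.log (∑ G ∈ S, Real.exp (f G))
      ≤ ∑ G ∈ S, μ G * f G - ∑ e ∈ edgesK n, negEnt (M e) := by
  set Z := ∑ G ∈ S, Real.exp (f G) with hZ
  have hZpos : 0 < Z := Finset.sum_pos (fun G _ => Real.exp_pos _) hS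
  have hμpos : ∀ G, 0 < μ G := fun G => by rw [hμ]; exact div_pos (Real.exp_pos _) hZpos
  have hμ1 : ∑ G ∈ S, μ G = 1 := by
    simp only [hμ, ← Finset.sum_div]
    exact div_self hZpos.ne'
  have hM0 : ∀ e, 0 ≤ M e := fun e => by
    rw [hM]
    exact Finset.sum_nonneg fun G _ => mul_nonneg (hμpos G).le (by split_ifs <;> norm_num)
  have hM' : ∀ e, 1 - M e = ∑ G ∈ S, μ G * (if e ∈ G.edgeSet then 0 else 1) := fun e => by
    refine sub_eq_of_eq_add (hμ1.symm.trans ?_)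
    rw [hM, ← Finset.sum_add_distrib]
    exact Finset.sum_congr rfl fun G _ => by split_ifs <;> ring
  have hM1 : ∀ e, M e ≤ 1 := fun e => by
    rw [← sub_nonneg, hM']
    exact Finset.sum_nonneg fun G _ => mul_nonneg (hμpos G).le (by split_ifs <;> norm_num)
  have hfac : ∀ G ∈ S, ∀ e ∈ edgesK n, 0 < (if e ∈ G.edgeSet then M e else 1 - M e) := by
    intro G hG e _
    split_ifs with he
    · rw [hM]
      refine lt_of_lt_of_le (hμpos G) ?_
      have := Finset.single_le_sum (f := fun G : SimpleGraph (Fin n) =>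
        μ G * (if e ∈ G.edgeSet then (1 : ℝ) else 0))
        (fun G _ => mul_nonneg (hμpos G).le (by split_ifs <;> norm_num)) hG
      simpa [he] using this
    · rw [hM']
      refine lt_of_lt_of_le (hμpos G) ?_
      have := Finset.single_le_sum (f := fun G : SimpleGraph (Fin n) =>
        μ G * (if e ∈ G.edgeSet then (0 : ℝ) else 1))
        (fun G _ => mul_nonneg (hμpos G).le (by split_ifs <;> norm_num)) hG
      simpa [he] using this
  have h := sum_mul_log_le_sum_mul_log (s := S) (p := μ) (r := bern M) (fun G _ => hμpos G)
    (fun G hG => Finset.prod_pos (hfac G hG)) hμ1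
    ((Finset.sum_le_univ_sum_of_nonneg fun G => bern_nonneg hM0 hM1 G).trans (sum_bern M).le)
  rw [sum_mul_log_bern hμ1 (fun e _ => (hM e).symm) fun G hG e he => (hfac G hG e he).ne'] at h
  have h2 : ∑ G ∈ S, μ G * Real.log (μ G) = ∑ G ∈ S, μ G * f G - Real.log Z := by
    rw [← one_mul (Real.log Z), ← hμ1, Finset.sum_mul, ← Finset.sum_sub_distrib]
    refine Finset.sum_congr rfl fun G _ => ?_
    rw [hμ, Real.log_div (Real.exp_pos _).ne' hZpos.ne', Real.log_exp]
    ring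
  linarith

/-- The Gibbs variational lower bound, tested with an Erdős–Rényi measure. -/
theorem le_log_sum_exp {n : ℕ} (f : SimpleGraph (Fin n) → ℝ) {u : ℝ} (hu : u ∈ Set.Ioo (0 : ℝ) 1) :
    ∑ G, bern (fun _ => u) G * f G - (edgesK n).card * negEnt u
      ≤ Real.log (∑ G, Real.exp (f G)) := by
  set q : SimpleGraph (Fin n) → ℝ := bern fun _ => u with hq
  set Z := ∑ G, Real.exp (f G) with hZ
  have hZpos : 0 < Z := Finset.sum_pos (fun G _ => Real.exp_pos _) Finset.univ_nonempty
  have hfac : ∀ (G : SimpleGraph (Fin n)) (e : Sym2 (Fin n)),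
      0 < (if e ∈ G.edgeSet then u else 1 - u) := fun G e => by
    split_ifs
    exacts [hu.1, sub_pos.2 hu.2]
  have hqpos : ∀ G, 0 < q G := fun G => Finset.prod_pos fun e _ => hfac G e
  have hq1 : ∑ G, q G = 1 := sum_bern _
  have h := sum_mul_log_le_sum_mul_log (s := Finset.univ) (p := q)
    (r := fun G => Real.exp (f G) / Z) (fun G _ => hqpos G)
    (fun G _ => div_pos (Real.exp_pos _) hZpos) hq1
    (by rw [← Finset.sum_div, div_self hZpos.ne'])
  have h1 := sum_mul_log_bern (S := Finset.univ) (M := fun _ : Sym2 (Fin n) => u) hq1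
    (fun e he => by
      have := sum_bern_mul_ite_subset u (Finset.singleton_subset_iff.2 he)
      simpa using this)
    (fun G _ e _ => (hfac G e).ne')
  have h2 : ∑ G, q G * Real.log (Real.exp (f G) / Z) = ∑ G, q G * f G - Real.log Z := by
    rw [← one_mul (Real.log Z), ← hq1, Finset.sum_mul, ← Finset.sum_sub_distrib]
    refine Finset.sum_congr rfl fun G _ => ?_
    rw [Real.log_div (Real.exp_pos _).ne' hZpos.ne', Real.log_exp]
    ring
  rw [Finset.sum_const, nsmul_eq_mul] at h1
  linarith

theorem negEnt_eq_neg_binEntropy : negEnt = fun u => -Real.binEntropy u := by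
  ext u
  simp only [negEnt, Real.binEntropy, Real.log_inv]
  ring

theorem gFun_eq (α h u : ℝ) : gFun α h u = α / 6 * u ^ 3 + h / 2 * u - negEnt u / 2 := rfl

theorem continuous_gFun (α h : ℝ) : Continuous (gFun α h) := by
  have : gFun α h = fun u => α / 6 * u ^ 3 + h / 2 * u - negEnt u / 2 := rfl
  rw [this, negEnt_eq_neg_binEntropy]
  fun_prop

theorem hasDerivAt_negEnt {u : ℝ} (hu : u ∈ Set.Ioo (0 : ℝ) 1) :
    HasDerivAt negEnt (Real.log u - Real.log (1 - u)) u := by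
  rw [negEnt_eq_neg_binEntropy]
  exact (Real.hasDerivAt_binEntropy hu.1.ne' hu.2.ne).neg.congr_deriv (neg_sub _ _)

/-- The quadratic lower bound for the binary relative entropy. -/
theorem le_negEnt {u v : ℝ} (hu : u ∈ Set.Ioo (0 : ℝ) 1) (hv : v ∈ Set.Icc (0 : ℝ) 1) :
    negEnt u + (Real.log u - Real.log (1 - u)) * (v - u) + 2 * (v - u) ^ 2 ≤ negEnt v := by
  set φ : ℝ → ℝ := fun x => negEnt x - 2 * x ^ 2 with hφ
  set φ' : ℝ → ℝ := fun x => Real.log x - Real.log (1 - x) - 4 * x with hφ'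
  have hd : ∀ x ∈ Set.Ioo (0 : ℝ) 1, HasDerivAt φ (φ' x) x := fun x hx => by
    have := (hasDerivAt_negEnt hx).sub (((hasDerivAt_id x).pow 2).const_mul 2)
    refine this.congr_deriv ?_
    simp only [hφ', id]
    ring
  have hd2 : ∀ x ∈ Set.Ioo (0 : ℝ) 1, HasDerivAt φ' (1 / x + 1 / (1 - x) - 4) x := fun x hx => by
    have h1 := Real.hasDerivAt_log hx.1.ne'
    have h2 := ((hasDerivAt_id x).const_sub 1).log (by simpa using (sub_pos.2 hx.2).ne')
    have := (h1.sub h2).sub ((hasDerivAt_id x).const_mul 4)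
    refine this.congr_deriv ?_
    simp only [id]
    ring
  have hconv : ConvexOn ℝ (Set.Icc (0 : ℝ) 1) φ := by
    refine convexOn_of_hasDerivWithinAt2_nonneg (f' := φ')
      (f'' := fun x => 1 / x + 1 / (1 - x) - 4) (convex_Icc 0 1) ?_ ?_ ?_ ?_
    · simp only [hφ, negEnt_eq_neg_binEntropy]
      fun_prop
    · rw [interior_Icc]
      exact fun x hx => (hd x hx).hasDerivWithinAt
    · rw [interior_Icc]
      exact fun x hx => (hd2 x hx).hasDerivWithinAt
    · rw [interior_Icc]
      intro x hx
      have h1 : 0 < x := hx.1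
      have h2 : 0 < 1 - x := sub_pos.2 hx.2
      rw [div_add_div _ _ h1.ne' h2.ne', sub_nonneg, le_div_iff₀ (mul_pos h1 h2)]
      nlinarith [sq_nonneg (2 * x - 1)]
  have huI : u ∈ Set.Icc (0 : ℝ) 1 := ⟨hu.1.le, hu.2.le⟩
  have htan : φ u + φ' u * (v - u) ≤ φ v := by
    rcases lt_trichotomy u v with huv | huv | huv
    · have := hconv.le_slope_of_hasDerivAt huI hv huv (hd u hu)
      rw [slope_def_field, le_div_iff₀ (sub_pos.2 huv)] at this
      linarith
    · simp [huv]
    · have := hconv.slope_le_of_hasDerivAt hv huI huv (hd u hu)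
      rw [slope_def_field, div_le_iff₀ (sub_pos.2 huv)] at this
      linarith
  simp only [hφ, hφ'] at htan
  nlinarith [htan]

theorem deriv_gFun_eq_zero {α h u : ℝ} (hu : u ∈ Set.Ioo (0 : ℝ) 1)
    (hmax : ∀ v ∈ Set.Icc (0 : ℝ) 1, gFun α h v ≤ gFun α h u) :
    α / 2 * u ^ 2 + h / 2 - (Real.log u - Real.log (1 - u)) / 2 = 0 := by
  have hloc : IsLocalMax (gFun α h) u := by
    filter_upwards [Icc_mem_nhds hu.1 hu.2] with v hv using hmax v hv
  have hd := ((((hasDerivAt_id u).pow 3).const_mul (α / 6)).add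
    ((hasDerivAt_id u).const_mul (h / 2))).sub ((hasDerivAt_negEnt hu).div_const 2)
  have h0 := hloc.hasDerivAt_eq_zero (f' := _) hd
  simp only [id] at h0
  linarith

theorem exists_pos_gap {g : ℝ → ℝ} (hg : Continuous g) {u : ℝ} (hu : u ∈ Set.Icc (0 : ℝ) 1)
    (hmax : ∀ v ∈ Set.Icc (0 : ℝ) 1, g v ≤ g u)
    (huniq : ∀ v ∈ Set.Icc (0 : ℝ) 1, g v = g u → v = u) {η : ℝ} (hη : 0 < η) :
    ∃ c > 0, ∀ v ∈ Set.Icc (0 : ℝ) 1, g v + c * (|v - u| - η) ≤ g u := by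
  set K : Set ℝ := Set.Icc (0 : ℝ) 1 ∩ {v | η ≤ |v - u|} with hK
  have hKc : IsCompact K := isCompact_Icc.inter_right
    (isClosed_le continuous_const (by fun_prop))
  obtain ⟨c, hc, hcK⟩ : ∃ c > 0, ∀ v ∈ K, g v + c ≤ g u := by
    rcases K.eq_empty_or_nonempty with hemp | hne
    · exact ⟨1, one_pos, by simp [hemp]⟩
    · obtain ⟨w, hw, hwmax⟩ := hKc.exists_isMaxOn hne hg.continuousOn
      have hwu : g w < g u := lt_of_le_of_ne (hmax w hw.1) fun h => by
        have h1 : η ≤ |w - u| := hw.2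
        rw [huniq w hw.1 h] at h1
        simp at h1
        linarith
      exact ⟨g u - g w, sub_pos.2 hwu, fun v hv => by linarith [isMaxOn_iff.1 hwmax v hv]⟩
  refine ⟨c, hc, fun v hv => ?_⟩
  by_cases hvη : η ≤ |v - u|
  · have h1 : |v - u| ≤ 1 := abs_le.2 ⟨by linarith [hv.1, hu.2], by linarith [hv.2, hu.1]⟩
    nlinarith [hcK v ⟨hv, hvη⟩]
  · nlinarith [hmax v hv, not_le.1 hvη]

theorem triSum_le {α : Type*} [Fintype α] {W : α → α → ℝ} (hW : ∀ i j, 0 ≤ W i j) :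
    triSum W ≤ Fintype.card α * ∑ i, ∑ j, W i j ^ 3 := by
  have amgm : ∀ x y z : ℝ, 0 ≤ x → 0 ≤ y → 0 ≤ z →
      x * y * z ≤ (x ^ 3 + y ^ 3 + z ^ 3) / 3 := fun x y z hx hy hz => by
    nlinarith [mul_nonneg (add_nonneg (add_nonneg hx hy) hz)
      (add_nonneg (add_nonneg (sq_nonneg (x - y)) (sq_nonneg (y - z))) (sq_nonneg (z - x)))]
  have h1 : triSum W ≤ ∑ i, ∑ j, ∑ k, (W i j ^ 3 + W j k ^ 3 + W k i ^ 3) / 3 :=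
    Finset.sum_le_sum fun i _ => Finset.sum_le_sum fun j _ => Finset.sum_le_sum fun k _ =>
      amgm _ _ _ (hW i j) (hW j k) (hW k i)
  refine h1.trans (le_of_eq ?_)
  have h2 : ∑ i : α, ∑ _j : α, ∑ k, W k i ^ 3 = Fintype.card α * ∑ i, ∑ j, W i j ^ 3 := by
    simp only [Finset.sum_const, Finset.card_univ, nsmul_eq_mul, ← Finset.mul_sum]
    rw [Finset.sum_comm]
  simp only [← Finset.sum_div, Finset.sum_add_distrib, h2]
  simp only [Finset.sum_const, Finset.card_univ, nsmul_eq_mul, ← Finset.mul_sum]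
  ring

/-- Comparison of the triangle sum with its second order expansion at a constant. -/
theorem le_triSum {α : Type*} [Fintype α] {W : α → α → ℝ} (hW0 : ∀ i j, 0 ≤ W i j)
    (hW1 : ∀ i j, W i j ≤ 1) (hsymm : ∀ i j, W i j = W j i) {u : ℝ} (hu0 : 0 ≤ u) (hu1 : u ≤ 1) :
    Fintype.card α * ∑ i, ∑ j, (u ^ 3 + 3 * u ^ 2 * (W i j - u) - (W i j - u) ^ 2)
      ≤ triSum W := by
  set D : α → α → ℝ := fun i j => W i j - u with hD
  have hDs : ∀ i j, D i j = D j i := fun i j => by simp only [hD, hsymm i j]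
  have hDabs : ∀ i j, |D i j| ≤ 1 := fun i j =>
    abs_le.2 ⟨by linarith [hW0 i j], by linarith [hW1 i j]⟩
  have hpt : ∀ i j k, u ^ 3 + u ^ 2 * (D i j + D j k + D k i)
      + u * (D i j * D j k + D j k * D k i + D k i * D i j)
      - (D i j ^ 2 + D j k ^ 2) / 2 ≤ W i j * W j k * W k i := fun i j k => by
    have h1 : -((D i j ^ 2 + D j k ^ 2) / 2) ≤ D i j * D j k * D k i := by
      have h2 : |D i j * D j k * D k i| ≤ |D i j| * |D j k| := by
        rw [abs_mul, abs_mul]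
        exact mul_le_of_le_one_right (by positivity) (hDabs k i)
      have h3 := neg_abs_le (D i j * D j k * D k i)
      nlinarith [sq_nonneg (|D i j| - |D j k|), sq_abs (D i j), sq_abs (D j k)]
    have h4 : W i j * W j k * W k i = (D i j + u) * (D j k + u) * (D k i + u) := by
      simp only [hD]; ring
    rw [h4]
    linarith
  have hsum := Finset.sum_le_sum fun i (_ : i ∈ Finset.univ) =>
    Finset.sum_le_sum fun j (_ : j ∈ Finset.univ) =>
      Finset.sum_le_sum fun k (_ : k ∈ Finset.univ) => hpt i j k
  refine le_trans ?_ hsum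
  change (Fintype.card α : ℝ) * ∑ i, ∑ j, (u ^ 3 + 3 * u ^ 2 * D i j - D i j ^ 2) ≤ _
  have hq1 : 0 ≤ ∑ i, ∑ j, ∑ k, D i j * D j k := by
    rw [Finset.sum_comm]
    refine Finset.sum_nonneg fun j _ => ?_
    have : ∑ i, ∑ k, D i j * D j k = (∑ i, D j i) ^ 2 := by
      rw [sq, Finset.sum_mul_sum]
      simp only [hDs _ j]
    rw [this]
    positivity
  have hq2 : 0 ≤ ∑ i, ∑ j, ∑ k, D j k * D k i := by
    convert hq1 using 1
    rw [Finset.sum_comm]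
    refine (Finset.sum_congr rfl fun _ _ => Finset.sum_comm).trans ?_
    rfl
  have hq3 : 0 ≤ ∑ i, ∑ j, ∑ k, D k i * D i j := by
    refine Finset.sum_nonneg fun i _ => ?_
    have : ∑ j, ∑ k, D k i * D i j = (∑ k, D i k) ^ 2 := by
      rw [sq, Finset.sum_mul_sum, Finset.sum_comm]
      simp only [hDs _ i]
    rw [this]
    positivity
  have e2 : ∑ i : α, ∑ _j : α, ∑ k, D k i = Fintype.card α * ∑ i, ∑ j, D i j := by
    simp only [Finset.sum_const, Finset.card_univ, nsmul_eq_mul, ← Finset.mul_sum]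
    rw [Finset.sum_comm]
  simp only [Finset.sum_add_distrib, Finset.sum_sub_distrib, ← Finset.mul_sum, mul_add,
    ← Finset.sum_div, e2] at hq1 ⊢
  simp only [Finset.sum_const, Finset.card_univ, nsmul_eq_mul, ← Finset.mul_sum]
  nlinarith [mul_nonneg hu0 hq1, mul_nonneg hu0 hq2, mul_nonneg hu0 hq3]

/-- Stability of the constant maximizer of the finite mean-field functional. -/
theorem exists_meanField_stability {α h u : ℝ} (hα : -2 < α) (hu : u ∈ Set.Ioo (0 : ℝ) 1)
    (hmax : ∀ v ∈ Set.Icc (0 : ℝ) 1, gFun α h v ≤ gFun α h u)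
    (huniq : ∀ v ∈ Set.Icc (0 : ℝ) 1, gFun α h v = gFun α h u → v = u) {η : ℝ} (hη : 0 < η) :
    ∃ c > 0, ∀ n : ℕ, 0 < n → ∀ W : Fin n → Fin n → ℝ, (∀ i j, 0 ≤ W i j) →
      (∀ i j, W i j ≤ 1) → (∀ i j, W i j = W j i) →
      α / (6 * n) * triSum W + ∑ i, ∑ j, (h / 2 * W i j - negEnt (W i j) / 2)
        + c * ∑ i, ∑ j, (|W i j - u| - η) ≤ (n : ℝ) ^ 2 * gFun α h u := by
  obtain ⟨c, hc, t, ht, htri⟩ : ∃ c > 0, ∃ t : ℝ → ℝ,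
      (∀ v ∈ Set.Icc (0 : ℝ) 1,
        t v + (h / 2 * v - negEnt v / 2) + c * (|v - u| - η) ≤ gFun α h u) ∧
      ∀ n : ℕ, 0 < n → ∀ W : Fin n → Fin n → ℝ, (∀ i j, 0 ≤ W i j) →
        (∀ i j, W i j ≤ 1) → (∀ i j, W i j = W j i) →
        α / (6 * n) * triSum W ≤ ∑ i, ∑ j, t (W i j) := by
    rcases le_or_gt 0 α with hα0 | hα0
    · obtain ⟨c, hc, hgap⟩ := exists_pos_gap (continuous_gFun α h) ⟨hu.1.le, hu.2.le⟩ hmax huniq hη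
      refine ⟨c, hc, fun v => α / 6 * v ^ 3, fun v hv => ?_, fun n hn W hW0 _ _ => ?_⟩
      · have := hgap v hv
        rw [gFun_eq α h v] at this
        linarith
      · have hn' : (0 : ℝ) < n := by exact_mod_cast hn
        have h1 := mul_le_mul_of_nonneg_left (triSum_le hW0)
          (show 0 ≤ α / (6 * n) by positivity)
        refine h1.trans (le_of_eq ?_)
        simp only [← Finset.mul_sum, Fintype.card_fin]
        field_simp
    · refine ⟨2 / 3 * η, by positivity,
        fun v => α / 6 * (u ^ 3 + 3 * u ^ 2 * (v - u) - (v - u) ^ 2), fun v hv => ?_,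
        fun n hn W hW0 hW1 hs => ?_⟩
      · have h1 := le_negEnt hu hv
        have h2 := deriv_gFun_eq_zero hu hmax
        rw [gFun_eq]
        have h3 : η * (|v - u| - η) ≤ (v - u) ^ 2 := by
          nlinarith [sq_abs (v - u), sq_nonneg (|v - u| - η), abs_nonneg (v - u), sq_nonneg η]
        have h4 : (α / 2 * u ^ 2 + h / 2 - (Real.log u - Real.log (1 - u)) / 2) * (v - u) = 0 := by
          rw [h2, zero_mul]
        nlinarith [sq_nonneg (v - u)]
      · have hn' : (0 : ℝ) < n := by exact_mod_cast hn
        have h1 := mul_le_mul_of_nonpos_left (le_triSum hW0 hW1 hs hu.1.le hu.2.le)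
          (show α / (6 * n) ≤ 0 from div_nonpos_of_nonpos_of_nonneg hα0.le (by positivity))
        refine h1.trans (le_of_eq ?_)
        simp only [← Finset.mul_sum, Fintype.card_fin]
        field_simp
  refine ⟨c, hc, fun n hn W hW0 hW1 hs => ?_⟩
  have h1 : ∑ i, ∑ j, (t (W i j) + (h / 2 * W i j - negEnt (W i j) / 2)
      + c * (|W i j - u| - η)) ≤ ∑ _i : Fin n, ∑ _j : Fin n, gFun α h u :=
    Finset.sum_le_sum fun i _ => Finset.sum_le_sum fun j _ => ht _ ⟨hW0 i j, hW1 i j⟩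
  have h2 : ∑ _i : Fin n, ∑ _j : Fin n, gFun α h u = (n : ℝ) ^ 2 * gFun α h u := by
    simp only [Finset.sum_const, Finset.card_univ, nsmul_eq_mul, Fintype.card_fin]
    ring
  have h3 := htri n hn W hW0 hW1 hs
  simp only [Finset.sum_add_distrib, ← Finset.mul_sum] at h1
  linarith

/-- The Hamiltonian of the edge-triangle model as a function of a weight matrix. -/
noncomputable def energy (α h : ℝ) {n : ℕ} (W : Fin n → Fin n → ℝ) : ℝ :=
  α / (6 * n) * triSum W + h / 2 * ∑ i, ∑ j, W i j

theorem gibbsWeight_eq (α h : ℝ) {n : ℕ} (G : SimpleGraph (Fin n)) :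
    gibbsWeight α h G = Real.exp (energy α h (adjW G)) := by
  rw [gibbsWeight, energy, ← six_mul_triCount, ← two_mul_edgeCount]
  congr 1
  rw [mul_comm 6 (n : ℝ), ← div_div]
  ring

theorem card_edgesK (n : ℕ) : 2 * ((edgesK n).card : ℝ) = (n : ℝ) ^ 2 - n := by
  have h := sum_sum_ite_eq_two_mul_sum_edgesK (n := n) fun _ => 1
  rw [Finset.sum_const, nsmul_eq_mul, mul_one] at h
  rw [← h]
  have h1 : ∀ i j : Fin n, (if i = j then (0 : ℝ) else 1) = 1 - if i = j then 1 else 0 :=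
    fun i j => by split_ifs <;> norm_num
  simp [h1, sq]

theorem abs_sum_bern_mul_adjW_sub_le {n : ℕ} {u : ℝ} (hu0 : 0 ≤ u) (hu1 : u ≤ 1) :
    |∑ G : SimpleGraph (Fin n), bern (fun _ => u) G * (∑ i, ∑ j, adjW G i j) - (n : ℝ) ^ 2 * u|
      ≤ n := by
  have hE : ∀ i j : Fin n, |∑ G : SimpleGraph (Fin n), bern (fun _ => u) G * adjW G i j - u|
      ≤ if i = j then 1 else 0 := fun i j => by
    by_cases hij : i = j
    · simp [hij, adjW, abs_of_nonneg hu0, hu1]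
    · have h := sum_bern_mul_ite_subset (n := n) u
        (Finset.singleton_subset_iff.2 (mem_edgesK.2 (show ¬ (s(i, j)).IsDiag by simpa using hij)))
      simp only [Finset.mem_singleton, forall_eq, SimpleGraph.mem_edgeSet, Finset.card_singleton,
        pow_one] at h
      have h' : ∑ G : SimpleGraph (Fin n), bern (fun _ => u) G * adjW G i j = u := by
        simpa only [adjW] using h
      rw [h', sub_self, abs_zero, if_neg hij]
  have h1 : ∑ G : SimpleGraph (Fin n), bern (fun _ => u) G * (∑ i, ∑ j, adjW G i j)
      - (n : ℝ) ^ 2 * u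
      = ∑ i, ∑ j, (∑ G : SimpleGraph (Fin n), bern (fun _ => u) G * adjW G i j - u) := by
    simp only [Finset.sum_sub_distrib, Finset.mul_sum]
    congr 1
    · rw [Finset.sum_comm]
      exact Finset.sum_congr rfl fun i _ => Finset.sum_comm
    · simp; ring
  rw [h1]
  refine (Finset.abs_sum_le_sum_abs _ _).trans ((Finset.sum_le_sum fun i _ =>
    (Finset.abs_sum_le_sum_abs _ _).trans (Finset.sum_le_sum fun j _ => hE i j)).trans ?_)
  simp

theorem abs_sum_bern_mul_triSum_sub_le {n : ℕ} {u : ℝ} (hu0 : 0 ≤ u) (hu1 : u ≤ 1) :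
    |∑ G : SimpleGraph (Fin n), bern (fun _ => u) G * triSum (adjW G) - (n : ℝ) ^ 3 * u ^ 3|
      ≤ 3 * (n : ℝ) ^ 2 := by
  have hu3 : u ^ 3 ≤ 1 := pow_le_one₀ hu0 hu1
  have hE : ∀ i j k : Fin n, |∑ G : SimpleGraph (Fin n),
      bern (fun _ => u) G * (adjW G i j * adjW G j k * adjW G k i) - u ^ 3|
      ≤ (if i = j then 1 else 0) + (if j = k then 1 else 0) + (if k = i then 1 else 0) := by
    intro i j k
    by_cases hd : i ≠ j ∧ j ≠ k ∧ k ≠ i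
    · obtain ⟨hij, hjk, hki⟩ := hd
      have hcard : ({s(i, j), s(j, k), s(k, i)} : Finset (Sym2 (Fin n))).card = 3 := by
        rw [Finset.card_eq_three]
        refine ⟨_, _, _, ?_, ?_, ?_, rfl⟩ <;>
        · rw [Ne, Sym2.eq_iff]
          grind
      have h := sum_bern_mul_ite_subset (n := n) u
        (s := {s(i, j), s(j, k), s(k, i)}) (fun e he => by
          simp only [Finset.mem_insert, Finset.mem_singleton] at he
          rw [mem_edgesK]
          rcases he with rfl | rfl | rfl <;> simpa)
      rw [hcard] at h
      have h2 : ∀ G : SimpleGraph (Fin n), adjW G i j * adjW G j k * adjW G k i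
          = if ∀ e ∈ ({s(i, j), s(j, k), s(k, i)} : Finset (Sym2 (Fin n))), e ∈ G.edgeSet
            then 1 else 0 := fun G => by
        simp only [Finset.mem_insert, Finset.mem_singleton, forall_eq_or_imp, forall_eq,
          SimpleGraph.mem_edgeSet, adjW]
        split_ifs <;> simp_all
      simp only [h2, h, sub_self, abs_zero]
      positivity
    · have h2 : ∀ G : SimpleGraph (Fin n), adjW G i j * adjW G j k * adjW G k i = 0 := fun G => by
        by_contra hne
        refine hd ⟨?_, ?_, ?_⟩ <;>
        · rintro rfl
          simp [adjW] at hne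
      simp only [h2, mul_zero, Finset.sum_const_zero, zero_sub, abs_neg]
      rw [abs_of_nonneg (by positivity)]
      refine hu3.trans ?_
      have hor : i = j ∨ j = k ∨ k = i := by tauto
      rcases hor with hd | hd | hd <;> rw [if_pos hd] <;> split_ifs <;> norm_num
  have h1 : ∑ G : SimpleGraph (Fin n), bern (fun _ => u) G * triSum (adjW G)
      - (n : ℝ) ^ 3 * u ^ 3
      = ∑ i, ∑ j, ∑ k, (∑ G : SimpleGraph (Fin n),
        bern (fun _ => u) G * (adjW G i j * adjW G j k * adjW G k i) - u ^ 3) := by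
    simp only [triSum, Finset.sum_sub_distrib, Finset.mul_sum]
    congr 1
    · rw [Finset.sum_comm]
      refine Finset.sum_congr rfl fun i _ => ?_
      rw [Finset.sum_comm]
      exact Finset.sum_congr rfl fun i _ => Finset.sum_comm
    · simp; ring
  rw [h1]
  refine (Finset.abs_sum_le_sum_abs _ _).trans ((Finset.sum_le_sum fun i _ =>
    (Finset.abs_sum_le_sum_abs _ _).trans (Finset.sum_le_sum fun j _ =>
      (Finset.abs_sum_le_sum_abs _ _).trans (Finset.sum_le_sum fun k _ => hE i j k))).trans ?_)
  simp only [Finset.sum_add_distrib]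
  simp
  apply le_of_eq
  ring

/-- Lower bound for the logarithm of the partition function. -/
theorem le_log_partition {α h u : ℝ} (hu : u ∈ Set.Ioo (0 : ℝ) 1) {n : ℕ} (hn : 0 < n) :
    (n : ℝ) ^ 2 * gFun α h u - (|α| + |h| + |negEnt u|) / 2 * n
      ≤ Real.log (∑ G : SimpleGraph (Fin n), Real.exp (energy α h (adjW G))) := by
  have hn' : (0 : ℝ) < n := by exact_mod_cast hn
  refine le_trans ?_ (le_log_sum_exp (fun G : SimpleGraph (Fin n) => energy α h (adjW G)) hu)
  set X := ∑ G : SimpleGraph (Fin n), bern (fun _ => u) G * triSum (adjW G) with hX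
  set Y := ∑ G : SimpleGraph (Fin n), bern (fun _ => u) G * (∑ i, ∑ j, adjW G i j) with hY
  have hsplit : ∑ G : SimpleGraph (Fin n), bern (fun _ => u) G * energy α h (adjW G)
      = α / (6 * n) * X + h / 2 * Y := by
    rw [hX, hY, Finset.mul_sum, Finset.mul_sum, ← Finset.sum_add_distrib]
    refine Finset.sum_congr rfl fun G _ => ?_
    rw [energy]
    ring
  have h1 : α / (6 * n) * ((n : ℝ) ^ 3 * u ^ 3) - |α| / 2 * n ≤ α / (6 * n) * X := by
    have h2 : |α / (6 * n) * (X - (n : ℝ) ^ 3 * u ^ 3)| ≤ |α| / 2 * n := by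
      rw [abs_mul, abs_div, abs_of_pos (show (0 : ℝ) < 6 * n by positivity)]
      refine (mul_le_mul_of_nonneg_left (abs_sum_bern_mul_triSum_sub_le hu.1.le hu.2.le)
        (by positivity)).trans (le_of_eq ?_)
      field_simp
      ring
    have h3 := (abs_le.1 h2).1
    rw [mul_sub] at h3
    linarith
  have h2 : h / 2 * ((n : ℝ) ^ 2 * u) - |h| / 2 * n ≤ h / 2 * Y := by
    have h2 : |h / 2 * (Y - (n : ℝ) ^ 2 * u)| ≤ |h| / 2 * n := by
      rw [abs_mul, abs_div, abs_of_pos (show (0 : ℝ) < 2 by norm_num)]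
      exact mul_le_mul_of_nonneg_left (abs_sum_bern_mul_adjW_sub_le hu.1.le hu.2.le)
        (by positivity)
    have h3 := (abs_le.1 h2).1
    rw [mul_sub] at h3
    linarith
  have h3 : ((edgesK n).card : ℝ) = ((n : ℝ) ^ 2 - n) / 2 := by linarith [card_edgesK n]
  have h4 : α / (6 * n) * ((n : ℝ) ^ 3 * u ^ 3) = (n : ℝ) ^ 2 * (α / 6 * u ^ 3) := by
    field_simp
  rw [hsplit, h3, gFun_eq]
  have h5 := mul_le_mul_of_nonneg_right (neg_abs_le (negEnt u)) hn'.le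
  rw [h4] at h1
  linarith

/-- Upper bound for the weight of a class of graphs of small cut diameter containing a graph with
atypical homomorphism density. -/
theorem log_sum_exp_energy_le {V : Type} [Fintype V] (H : SimpleGraph V) {α h u c η δ ε : ℝ}
    (hu : u ∈ Set.Ioo (0 : ℝ) 1) (hc : 0 < c) {n : ℕ} (hn : 0 < n)
    (hstab : ∀ W : Fin n → Fin n → ℝ, (∀ i j, 0 ≤ W i j) →
      (∀ i j, W i j ≤ 1) → (∀ i j, W i j = W j i) →
      α / (6 * n) * triSum W + ∑ i, ∑ j, (h / 2 * W i j - negEnt (W i j) / 2)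
        + c * ∑ i, ∑ j, (|W i j - u| - η) ≤ (n : ℝ) ^ 2 * gFun α h u)
    (hε : edgeNum H * (δ + 2 * η) < ε) {S : Finset (SimpleGraph (Fin n))} (hS : S.Nonempty)
    (hdiam : ∀ G ∈ S, ∀ G' ∈ S,
      CutLE (fun i j => adjW G i j - adjW G' i j) (δ * (n : ℝ) ^ 2))
    (hbad : ∀ G ∈ S, ε ≤ |homDensity H G - u ^ edgeNum H|) :
    Real.log (∑ G ∈ S, Real.exp (energy α h (adjW G)))
      ≤ (n : ℝ) ^ 2 * (gFun α h u - c * η + |α| * δ / 2) := by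
  have hn' : (0 : ℝ) < n := by exact_mod_cast hn
  have hne : Nonempty (Fin n) := ⟨⟨0, hn⟩⟩
  set f : SimpleGraph (Fin n) → ℝ := fun G => energy α h (adjW G) with hf
  set μ : SimpleGraph (Fin n) → ℝ := fun G => Real.exp (f G) / ∑ G' ∈ S, Real.exp (f G') with hμ
  set M : Sym2 (Fin n) → ℝ := fun e => ∑ G ∈ S, μ G * (if e ∈ G.edgeSet then 1 else 0) with hM
  set W : Fin n → Fin n → ℝ := fun i j => ∑ G ∈ S, μ G * adjW G i j with hW
  have hZpos : 0 < ∑ G ∈ S, Real.exp (f G) := Finset.sum_pos (fun G _ => Real.exp_pos _) hS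
  have hμ0 : ∀ G, 0 ≤ μ G := fun G => (div_pos (Real.exp_pos _) hZpos).le
  have hμ1 : ∑ G ∈ S, μ G = 1 := by
    simp only [hμ, ← Finset.sum_div]
    exact div_self hZpos.ne'
  have hW0 : ∀ i j, 0 ≤ W i j := fun i j =>
    Finset.sum_nonneg fun G _ => mul_nonneg (hμ0 G) (adjW_nonneg G i j)
  have hW1 : ∀ i j, W i j ≤ 1 := fun i j => by
    rw [← hμ1]
    exact Finset.sum_le_sum fun G _ => mul_le_of_le_one_right (hμ0 G) (adjW_le_one G i j)
  have hWs : ∀ i j, W i j = W j i := fun i j =>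
    Finset.sum_congr rfl fun G _ => by rw [adjW_comm]
  have hcut : ∀ G ∈ S, CutLE (fun i j => adjW G i j - W i j) (δ * (n : ℝ) ^ 2) := fun G hG => by
    have h1 := CutLE.sum_mul (fun G' _ => hμ0 G') hμ1 (hdiam G hG)
    have h2 : ∀ i j, ∑ G' ∈ S, μ G' * (adjW G i j - adjW G' i j) = adjW G i j - W i j :=
      fun i j => by
        simp only [mul_sub, Finset.sum_sub_distrib, ← Finset.sum_mul, hμ1, one_mul, hW]
    simpa only [h2] using h1
  have hent : ∑ e ∈ edgesK n, negEnt (M e) = ∑ i, ∑ j, negEnt (W i j) / 2 := by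
    have h1 := sum_sum_ite_eq_two_mul_sum_edgesK fun e : Sym2 (Fin n) => negEnt (M e)
    simp only [← Finset.sum_div]
    rw [eq_div_iff two_ne_zero, mul_comm, ← h1]
    refine Finset.sum_congr rfl fun i _ => Finset.sum_congr rfl fun j _ => ?_
    by_cases hij : i = j
    · simp [hij, hW, adjW, negEnt]
    · simp [hij, hW, hM, adjW, SimpleGraph.mem_edgeSet]
  have henergy : ∑ G ∈ S, μ G * f G
      ≤ α / (6 * n) * triSum W + h / 2 * ∑ i, ∑ j, W i j + |α| * δ / 2 * (n : ℝ) ^ 2 := by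
    have h1 : ∀ G ∈ S, α / (6 * n) * triSum (adjW G)
        ≤ α / (6 * n) * triSum W + |α| * δ / 2 * (n : ℝ) ^ 2 := fun G hG => by
      have h2 := abs_triSum_sub_triSum_le (adjW_nonneg G) (adjW_le_one G) hW0 hW1
        (δ := δ) (by simpa using hcut G hG)
      have h3 : |α / (6 * n) * (triSum (adjW G) - triSum W)| ≤ |α| * δ / 2 * (n : ℝ) ^ 2 := by
        rw [abs_mul, abs_div, abs_of_pos (show (0 : ℝ) < 6 * n by positivity)]
        refine (mul_le_mul_of_nonneg_left h2 (by positivity)).trans (le_of_eq ?_)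
        rw [Fintype.card_fin]
        field_simp
        ring
      have h4 := (abs_le.1 h3).2
      rw [mul_sub] at h4
      linarith
    have h5 : ∑ G ∈ S, μ G * (h / 2 * ∑ i, ∑ j, adjW G i j) = h / 2 * ∑ i, ∑ j, W i j := by
      simp only [hW, Finset.mul_sum]
      rw [Finset.sum_comm]
      refine Finset.sum_congr rfl fun i _ => ?_
      rw [Finset.sum_comm]
      refine Finset.sum_congr rfl fun j _ => Finset.sum_congr rfl fun G _ => by ring
    have h6 : ∑ G ∈ S, μ G * (α / (6 * n) * triSum (adjW G))
        ≤ α / (6 * n) * triSum W + |α| * δ / 2 * (n : ℝ) ^ 2 := by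
      refine (Finset.sum_le_sum fun G hG => mul_le_mul_of_nonneg_left (h1 G hG) (hμ0 G)).trans ?_
      rw [← Finset.sum_mul, hμ1, one_mul]
    simp only [hf, energy, mul_add, Finset.sum_add_distrib]
    linarith
  have hfar : η * (n : ℝ) ^ 2 ≤ ∑ i, ∑ j, (|W i j - u| - η) := by
    by_contra hcon
    obtain ⟨G, hG⟩ := hS
    have h1 : ∑ i, ∑ j, |W i j - u| ≤ 2 * η * (n : ℝ) ^ 2 := by
      simp only [Finset.sum_sub_distrib, Finset.sum_const, Finset.card_univ, nsmul_eq_mul,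
        Fintype.card_fin] at hcon
      nlinarith
    have h2 := (hcut G hG).add (CutLE.of_sum_abs_le h1)
    have h3 := abs_homDensity_sub_pow_le H hn G hu.1.le hu.2.le (δ := δ + 2 * η) (by
      convert h2 using 1
      · ext i j; ring
      · ring)
    linarith [hbad G hG]
  have h1 := log_sum_exp_le f hS (fun _ => rfl) (M := M) (fun _ => rfl)
  have h2 := hstab W hW0 hW1 hWs
  simp only [Finset.sum_sub_distrib, ← Finset.mul_sum] at h2
  simp only [Finset.sum_sub_distrib] at hfar
  rw [hent] at h1
  have h3 := mul_le_mul_of_nonneg_left hfar hc.le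
  linarith

theorem sum_sum_adjW_sq_le {n : ℕ} (G : SimpleGraph (Fin n)) :
    ∑ i, ∑ j, adjW G i j ^ 2 ≤ (n : ℝ) ^ 2 := by
  refine (Finset.sum_le_sum fun i _ => Finset.sum_le_sum fun j _ =>
    pow_le_one₀ (adjW_nonneg G i j) (adjW_le_one G i j)).trans (le_of_eq ?_)
  simp [sq]

/-- All graphs are coded by boundedly many pairs of vertex sets, with graphs of the same code at
small cut distance. -/
theorem exists_code {δ : ℝ} (hδ : 0 < δ) : ∃ k : ℕ, ∀ n : ℕ,
    ∃ code : SimpleGraph (Fin n) → (Fin k → Bool × Finset (Fin n) × Finset (Fin n)),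
      ∀ G G', code G = code G' →
        CutLE (fun i j => adjW G i j - adjW G' i j) (δ * (n : ℝ) ^ 2) := by
  obtain ⟨k, hk⟩ := exists_nat_ge (1 / (δ / 2) ^ 2)
  refine ⟨k, fun n => ?_⟩
  have hex : ∀ G : SimpleGraph (Fin n), ∃ c : Fin k → Bool × Finset (Fin n) × Finset (Fin n),
      CutLE (fun i j => adjW G i j - rectSum (δ / 2) c i j) (δ / 2 * (n : ℝ) ^ 2) := fun G => by
    have := exists_rectSum_cutLE (δ := δ / 2) (by positivity) k (adjW G) (by
      refine (sum_sum_adjW_sq_le G).trans ?_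
      rw [div_le_iff₀ (by positivity)] at hk
      rw [Fintype.card_fin, ← mul_assoc]
      exact le_mul_of_one_le_left (by positivity) hk)
    simpa using this
  choose code hcode using hex
  refine ⟨code, fun G G' hGG' => ?_⟩
  have h := (hcode G).sub (hcode G')
  rw [hGG'] at h
  convert h using 1
  · ext i j; ring
  · ring

theorem card_code_le (k n : ℕ) (hn : 0 < n) :
    (Fintype.card (Fin k → Bool × Finset (Fin n) × Finset (Fin n)) : ℝ)
      ≤ Real.exp (3 * k * n) := by
  have h2 : (2 : ℝ) ≤ Real.exp 1 := by linarith [Real.add_one_le_exp (1 : ℝ)]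
  have h1 : (Fintype.card (Fin k → Bool × Finset (Fin n) × Finset (Fin n)) : ℝ)
      = 2 ^ ((1 + n + n) * k) := by
    simp only [Fintype.card_fun, Fintype.card_prod, Fintype.card_bool, Fintype.card_finset,
      Fintype.card_fin]
    push_cast
    rw [pow_mul, pow_add, pow_add]
    ring
  rw [h1]
  calc (2 : ℝ) ^ ((1 + n + n) * k) ≤ Real.exp 1 ^ ((1 + n + n) * k) := by gcongr
    _ = Real.exp (((1 + n + n) * k : ℕ) : ℝ) := by rw [← Real.exp_nat_mul, mul_one]
    _ ≤ Real.exp (3 * k * n) := by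
      refine Real.exp_le_exp.2 ?_
      have h3 : (1 + n + n) * k ≤ 3 * k * n := by nlinarith
      exact_mod_cast h3

/-- Exponential concentration of a general homomorphism density in the uniqueness regime. -/
theorem edge_triangle_homDensity_concentration_unique_maximizer
    {V : Type} [Fintype V] (H : SimpleGraph V)
    (α h : ℝ) (hα : α > -2) (u₀ : ℝ) (hu₀ : u₀ ∈ Set.Ioo (0 : ℝ) 1)
    (hmax : ∀ u ∈ Set.Icc (0 : ℝ) 1, gFun α h u ≤ gFun α h u₀)
    (huniq : ∀ u ∈ Set.Icc (0 : ℝ) 1, gFun α h u = gFun α h u₀ → u = u₀) :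
    ∀ ε > 0, ∃ τ > 0, ∃ N : ℕ, ∀ n ≥ N,
      gibbsProb α h n
          {G : SimpleGraph (Fin n) | ε ≤ |homDensity H G - u₀ ^ (edgeNum H)|} ≤
        Real.exp (-τ * (n : ℝ) ^ 2) := by
  intro ε hε
  set E : ℝ := (edgeNum H : ℝ)
  have hE0 : 0 ≤ E := Nat.cast_nonneg _
  set η : ℝ := ε / (4 * (E + 1)) with hη
  have hηpos : 0 < η := by positivity
  obtain ⟨c, hc, hstab⟩ := exists_meanField_stability hα hu₀ hmax huniq hηpos
  set κ : ℝ := c * η / 4 with hκ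
  have hκpos : 0 < κ := by positivity
  obtain ⟨δ, hδ, hδη, hδα⟩ : ∃ δ > 0, δ ≤ η ∧ |α| * δ / 2 ≤ κ := by
    refine ⟨min η (κ / (|α| + 1)), by positivity, min_le_left _ _, ?_⟩
    have h1 : |α| * min η (κ / (|α| + 1)) ≤ |α| * (κ / (|α| + 1)) :=
      mul_le_mul_of_nonneg_left (min_le_right _ _) (abs_nonneg α)
    have h2 : |α| * (κ / (|α| + 1)) ≤ κ := by
      rw [← mul_div_assoc, div_le_iff₀ (by positivity)]
      nlinarith
    linarith
  have hεE : E * (δ + 2 * η) < ε := by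
    have h1 : 4 * (E + 1) * η = ε := by
      rw [hη]
      field_simp
    nlinarith
  obtain ⟨k, hk⟩ := exists_code hδ
  set C : ℝ := (|α| + |h| + |negEnt u₀|) / 2 with hC
  obtain ⟨N, hN⟩ := exists_nat_ge ((3 * k + C) / κ)
  refine ⟨κ, hκpos, max N 1, fun n hn => ?_⟩
  have hn1 : 0 < n := lt_of_lt_of_le one_pos ((le_max_right N 1).trans hn)
  have hn' : (0 : ℝ) < n := by exact_mod_cast hn1
  have hnN : 3 * k + C ≤ κ * n := by
    have h1 : (N : ℝ) ≤ n := by exact_mod_cast (le_max_left N 1).trans hn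
    rw [div_le_iff₀ hκpos] at hN
    nlinarith
  obtain ⟨code, hcode⟩ := hk n
  set g : ℝ := gFun α h u₀ with hg
  set f : SimpleGraph (Fin n) → ℝ := fun G => energy α h (adjW G) with hf
  set B : Finset (SimpleGraph (Fin n)) :=
    Finset.univ.filter fun G => ε ≤ |homDensity H G - u₀ ^ edgeNum H| with hB
  have hclass : ∀ d, ∑ G ∈ B with code G = d, Real.exp (f G)
      ≤ Real.exp ((n : ℝ) ^ 2 * (g - 3 * κ)) := fun d => by
    rcases (B.filter fun G => code G = d).eq_empty_or_nonempty with hemp | hne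
    · rw [hemp, Finset.sum_empty]
      exact (Real.exp_pos _).le
    · have h1 := log_sum_exp_energy_le (α := α) (h := h) (δ := δ) H hu₀ hc hn1
        (hstab n hn1) hεE hne
        (fun G hG G' hG' => hcode G G' (by
          rw [(Finset.mem_filter.1 hG).2, (Finset.mem_filter.1 hG').2]))
        (fun G hG => (Finset.mem_filter.1 (Finset.mem_filter.1 hG).1).2)
      rw [Real.log_le_iff_le_exp (Finset.sum_pos (fun G _ => Real.exp_pos _) hne)] at h1
      refine h1.trans (Real.exp_le_exp.2 (mul_le_mul_of_nonneg_left ?_ (by positivity)))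
      linarith
  have hnum : ∑ G ∈ B, Real.exp (f G)
      ≤ Real.exp (3 * k * n) * Real.exp ((n : ℝ) ^ 2 * (g - 3 * κ)) := by
    rw [← Finset.sum_fiberwise B code]
    refine (Finset.sum_le_sum fun d _ => hclass d).trans ?_
    rw [Finset.sum_const, Finset.card_univ, nsmul_eq_mul]
    exact mul_le_mul_of_nonneg_right (card_code_le k n hn1) (Real.exp_pos _).le
  have hden : Real.exp ((n : ℝ) ^ 2 * g - C * n) ≤ ∑ G, Real.exp (f G) := by
    rw [← Real.le_log_iff_exp_le
      (Finset.sum_pos (fun G _ => Real.exp_pos _) Finset.univ_nonempty)]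
    exact le_log_partition hu₀ hn1
  have hprob : gibbsProb α h n {G : SimpleGraph (Fin n) | ε ≤ |homDensity H G - u₀ ^ edgeNum H|}
      = (∑ G ∈ B, Real.exp (f G)) / ∑ G, Real.exp (f G) := by
    simp only [gibbsProb, gibbsWeight_eq, Set.mem_ofPred_eq, hB, hf, Finset.sum_filter]
  rw [hprob, div_le_iff₀ (lt_of_lt_of_le (Real.exp_pos _) hden)]
  calc ∑ G ∈ B, Real.exp (f G)
      ≤ Real.exp (3 * k * n + (n : ℝ) ^ 2 * (g - 3 * κ)) := by rwa [Real.exp_add]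
    _ ≤ Real.exp (-κ * (n : ℝ) ^ 2 + ((n : ℝ) ^ 2 * g - C * n)) := by
        refine Real.exp_le_exp.2 ?_
        nlinarith [mul_le_mul_of_nonneg_right hnN hn'.le,
          mul_nonneg hκpos.le (sq_nonneg (n : ℝ))]
    _ = Real.exp (-κ * (n : ℝ) ^ 2) * Real.exp ((n : ℝ) ^ 2 * g - C * n) := Real.exp_add _ _
    _ ≤ _ := mul_le_mul_of_nonneg_left hden (Real.exp_pos _).le
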